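/- Let n ≥ 2 and let 0 < a_1 < a_2 < ⋯ < a_{n−1} be positive integers, and set λ := Σ_{i=1}^{n−1} a_i α_i. Then the weighted Kostant sum satisfies S(λ) = q^{−Σ_{i=1}^{n−1} a_i} · (q−1)^{2(n−1)} · [a_1]_{q^n} · ∏_{j=1}^{n−2} [(j+1)a_{n−j} − j·a_{n−j−1}]_q. -/

import Mathlib

noncomputable def q : RatFunc ℚ := RatFunc.X

noncomputable def qint (b : RatFunc ℚ) (k : ℤ) : RatFunc ℚ := (b ^ k - 1) / (b - 1)

noncomputable def wt (r : ℕ) : RatFunc ℚ :=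
  if r = 0 then 1
  else q ^ (-(r : ℤ)) * (q - 1) ^ 2 * (q ^ (2 * r) - 1) / (q ^ 2 - 1)

def rootZ (i j : ℕ) : ℕ → ℤ := fun k => (if k = i then 1 else 0) - (if k = j then 1 else 0)

def pairs (n : ℕ) : Finset (ℕ × ℕ) :=
  (Finset.Icc 1 n ×ˢ Finset.Icc 1 n).filter fun p => p.1 < p.2

def IsKostant (n : ℕ) (lam : ℕ → ℤ) (r : ℕ × ℕ → ℕ) : Prop :=
  (∀ p ∉ pairs n, r p = 0) ∧
    (∑ p ∈ pairs n, (r p : ℤ) • rootZ p.1 p.2) = lam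

noncomputable def S (n : ℕ) (lam : ℕ → ℤ) : RatFunc ℚ :=
  ∑ᶠ r ∈ {r : ℕ × ℕ → ℕ | IsKostant n lam r}, ∏ p ∈ pairs n, wt (r p)

lemma q_ne_zero' : q ≠ 0 := RatFunc.X_ne_zero

lemma q_pow_ne_one (N : ℕ) (hN : 0 < N) : q ^ N ≠ 1 := by
  intro h
  have h2 : (algebraMap (Polynomial ℚ) (RatFunc ℚ)) (Polynomial.X ^ N) =
      algebraMap (Polynomial ℚ) (RatFunc ℚ) 1 := by
    rw [map_pow, RatFunc.algebraMap_X, map_one]; exact h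
  have h3 := RatFunc.algebraMap_injective ℚ h2
  have h4 := congrArg Polynomial.natDegree h3
  simp at h4
  omega

noncomputable def cA (N : ℕ) : RatFunc ℚ := (q - 1) * (q ^ N - 1) / (q ^ (N + 1) - 1)

noncomputable def hh (N k : ℕ) : RatFunc ℚ :=
  if k = 0 then 1 else cA N * ((q ^ N) ^ k - (q⁻¹) ^ k)

lemma q_sub_ne (N : ℕ) (hN : 0 < N) : q ^ N - 1 ≠ 0 := sub_ne_zero.mpr (q_pow_ne_one N hN)

lemma wt_eq_hh (k : ℕ) : wt k = hh 1 k := by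
  unfold wt hh cA
  split_ifs with h
  · rfl
  · have h1 := q_ne_zero'
    have h2 := q_sub_ne 2 (by norm_num)
    have : q ^ (2 * k) = q ^ k * q ^ k := by ring
    rw [this, zpow_neg, zpow_natCast, inv_pow]
    field_simp

open PowerSeries in
lemma geom_mul (c : RatFunc ℚ) : (1 - C c * X) * PowerSeries.mk (fun k => c ^ k) = 1 := by
  ext k
  cases k with
  | zero => simp [sub_mul, mul_assoc]
  | succ k =>
    rw [sub_mul, one_mul, mul_assoc, map_sub, coeff_C_mul, coeff_succ_X_mul]
    simp [coeff_one, pow_succ, mul_comm]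

open PowerSeries in
lemma hh_series (N : ℕ) (c : RatFunc ℚ) :
    (1 - C (q ^ N * c) * X) * (1 - C (q⁻¹ * c) * X) * PowerSeries.mk (fun k => hh N k * c ^ k)
      = (1 - C c * X) * (1 - C (q ^ N * q⁻¹ * c) * X) := by
  have e : PowerSeries.mk (fun k => hh N k * c ^ k) =
      1 + C (cA N) * (PowerSeries.mk (fun k => (q ^ N * c) ^ k)
        - PowerSeries.mk (fun k => (q⁻¹ * c) ^ k)) := by
    ext k
    rw [map_add, coeff_C_mul, map_sub]
    simp only [coeff_mk, coeff_one, hh]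
    split_ifs with h
    · subst h; simp
    · simp only [mul_pow]; ring
  have g1 := geom_mul (q ^ N * c)
  have g2 := geom_mul (q⁻¹ * c)
  have hA : cA N * (q ^ N - q⁻¹) = q ^ N + q⁻¹ - 1 - q ^ N * q⁻¹ := by
    have h1 := q_ne_zero'
    have h2 := q_sub_ne (N + 1) (by omega)
    unfold cA
    rw [div_mul_eq_mul_div, div_eq_iff h2]
    field_simp
    ring
  have hC : C (cA N) * (C (q ^ N) - C (q⁻¹)) =
      C (q ^ N) + C (q⁻¹) - 1 - C (q ^ N) * C (q⁻¹) := by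
    rw [← map_one C, ← map_sub, ← map_mul, ← map_add, ← map_sub, ← map_mul, ← map_sub, hA]
  rw [e]
  set G1 := PowerSeries.mk (fun k => (q ^ N * c) ^ k)
  set G2 := PowerSeries.mk (fun k => (q⁻¹ * c) ^ k)
  simp only [map_mul] at g1 g2 ⊢
  linear_combination (C (cA N)) * (1 - C (q⁻¹) * C c * X) * g1
    - (C (cA N)) * (1 - C (q ^ N) * C c * X) * g2 + C c * X * hC

open PowerSeries in
lemma one_sub_ne (c : RatFunc ℚ) : (1 - C c * X : PowerSeries (RatFunc ℚ)) ≠ 0 := by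
  intro h
  have := congrArg (PowerSeries.constantCoeff) h
  simp at this

lemma conv_eq (f g : ℕ → RatFunc ℚ) (F : ℕ → RatFunc ℚ)
    (h : PowerSeries.mk f * PowerSeries.mk g = PowerSeries.mk F) (k : ℕ) :
    ∑ d ∈ Finset.range (k + 1), f d * g (k - d) = F k := by
  have := congrArg (PowerSeries.coeff k) h
  rw [PowerSeries.coeff_mul, Finset.Nat.sum_antidiagonal_eq_sum_range_succ_mk] at this
  simpa using this

open PowerSeries in
lemma conv1 (N k : ℕ) :
    ∑ d ∈ Finset.range (k + 1), (hh 1 d * (q ^ N) ^ d) * hh N (k - d) = hh (N + 1) k := by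
  apply conv_eq (fun d => hh 1 d * (q ^ N) ^ d) (hh N) (hh (N + 1))
  have a1 := hh_series 1 (q ^ N)
  have a2 := hh_series N 1
  have a3 := hh_series (N + 1) 1
  simp only [one_pow, mul_one] at a2 a3
  have h1 := q_ne_zero'
  have e1 : q ^ 1 * q⁻¹ * q ^ N = q ^ N := by field_simp
  have e2 : q ^ 1 * q ^ N = q ^ (N + 1) := by ring
  have e3 : q ^ (N + 1) * q⁻¹ = q ^ N := by field_simp; ring
  have e4 : q⁻¹ * q ^ N = q ^ N * q⁻¹ := by ring
  rw [e1, e2, e4] at a1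
  rw [e3] at a3
  apply mul_left_cancel₀ (one_sub_ne (q ^ (N + 1)))
  apply mul_left_cancel₀ (one_sub_ne (q ^ N * q⁻¹))
  apply mul_left_cancel₀ (one_sub_ne (q ^ N))
  apply mul_left_cancel₀ (one_sub_ne (q⁻¹))
  have t : (PowerSeries.mk fun k => hh N k) = PowerSeries.mk (hh N) := rfl
  have t' : (PowerSeries.mk fun k => hh (N+1) k) = PowerSeries.mk (hh (N+1)) := rfl
  rw [t] at a2
  rw [t'] at a3
  set P1 := PowerSeries.mk (fun k => hh 1 k * (q ^ N) ^ k)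
  linear_combination (1 - C (q ^ N) * X) * (1 - C q⁻¹ * X) * PowerSeries.mk (hh N) * a1
    + (1 - C (q ^ N) * X) * (1 - C (q ^ N) * X) * a2 - (1 - C (q ^ N) * X) * (1 - C (q ^ N * q⁻¹) * X) * a3

open PowerSeries in
lemma conv2 (N k : ℕ) :
    ∑ d ∈ Finset.range (k + 1), (hh 1 d * (q⁻¹) ^ d) * hh N (k - d) = hh (N + 1) k * (q⁻¹) ^ k := by
  apply conv_eq (fun d => hh 1 d * (q⁻¹) ^ d) (hh N) (fun k => hh (N + 1) k * (q⁻¹) ^ k)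
  have a1 := hh_series 1 (q⁻¹)
  have a2 := hh_series N 1
  have a3 := hh_series (N + 1) (q⁻¹)
  simp only [one_pow, mul_one] at a2
  have h1 := q_ne_zero'
  have e1 : q ^ 1 * q⁻¹ * q⁻¹ = q⁻¹ := by field_simp
  have e2 : q ^ 1 * q⁻¹ = 1 := by field_simp
  have e3 : q ^ (N + 1) * q⁻¹ = q ^ N := by field_simp; ring
  rw [e1, e2] at a1
  rw [e3] at a3
  apply mul_left_cancel₀ (one_sub_ne 1)
  apply mul_left_cancel₀ (one_sub_ne (q⁻¹ * q⁻¹))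
  apply mul_left_cancel₀ (one_sub_ne (q ^ N))
  apply mul_left_cancel₀ (one_sub_ne (q⁻¹))
  have t : (PowerSeries.mk fun k => hh N k) = PowerSeries.mk (hh N) := rfl
  rw [t] at a2
  set P1 := PowerSeries.mk (fun k => hh 1 k * (q⁻¹) ^ k)
  linear_combination (1 - C (q ^ N) * X) * (1 - C q⁻¹ * X) * PowerSeries.mk (hh N) * a1
    + (1 - C q⁻¹ * X) * (1 - C q⁻¹ * X) * a2 - (1 - C q⁻¹ * X) * (1 - C 1 * X) * a3

/-- flows on vertices 0..m with sink m+1 -/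
def IsFlow (m : ℕ) (b : ℕ → ℕ) (r : ℕ × ℕ → ℕ) : Prop :=
  (∀ i j, ¬ (i < j ∧ j ≤ m + 1) → r (i, j) = 0) ∧
    ∀ k ≤ m, ∑ j ∈ Finset.range (m + 2), r (k, j) = b k + ∑ i ∈ Finset.range k, r (i, k)

def extD (m : ℕ) (p : ∀ i ∈ Finset.range (m + 1), ℕ) (i : ℕ) : ℕ :=
  if h : i ∈ Finset.range (m + 1) then p i h else 0

def splitR (m : ℕ) (b : ℕ → ℕ) (r : ℕ × ℕ → ℕ) (d : ℕ → ℕ) : ℕ × ℕ → ℕ := fun x =>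
  if x.2 = m + 2 then
    (if x.1 = m + 1 then b (m + 1) + ∑ i ∈ Finset.range (m + 1), d i
      else r (x.1, m + 1) - d x.1)
  else if x.2 = m + 1 then d x.1
  else r x

def mergeR (m : ℕ) (r : ℕ × ℕ → ℕ) : ℕ × ℕ → ℕ := fun x =>
  if x.2 = m + 1 then (if x.1 ≤ m then r (x.1, m + 1) + r (x.1, m + 2) else 0)
  else if x.2 = m + 2 then 0 else r x

lemma merge_flow (m : ℕ) (b : ℕ → ℕ) (r : ℕ × ℕ → ℕ) (h : IsFlow (m + 1) b r) :
    IsFlow m b (mergeR m r) := by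
  obtain ⟨h1, h2⟩ := h
  refine ⟨?_, ?_⟩
  · intro i j hij
    unfold mergeR
    dsimp only
    split_ifs with c1 c2 c3
    · omega
    · rfl
    · rfl
    · apply h1; omega
  · intro k hk
    have := h2 k (by omega)
    rw [Finset.sum_range_succ, Finset.sum_range_succ] at this
    rw [Finset.sum_range_succ]
    have e1 : ∑ j ∈ Finset.range (m + 1), mergeR m r (k, j) = ∑ j ∈ Finset.range (m + 1), r (k, j) := by
      apply Finset.sum_congr rfl
      intro j hj
      rw [Finset.mem_range] at hj
      unfold mergeR
      dsimp only
      rw [if_neg (by omega), if_neg (by omega)]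
    have e2 : ∑ i ∈ Finset.range k, mergeR m r (i, k) = ∑ i ∈ Finset.range k, r (i, k) := by
      apply Finset.sum_congr rfl
      intro j hj
      unfold mergeR
      dsimp only
      rw [if_neg (by omega), if_neg (by omega)]
    have e3 : mergeR m r (k, m + 1) = r (k, m + 1) + r (k, m + 2) := by
      simp [mergeR, hk]
    rw [e1, e2, e3, ← this]
    ring

lemma split_flow (m : ℕ) (b : ℕ → ℕ) (r : ℕ × ℕ → ℕ) (d : ℕ → ℕ) (h : IsFlow m b r)
    (hd : ∀ i, d i ≤ r (i, m + 1)) : IsFlow (m + 1) b (splitR m b r d) := by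
  obtain ⟨h1, h2⟩ := h
  have hd0 : ∀ i, m < i → d i = 0 := by
    intro i hi
    have := hd i
    rw [h1 i (m + 1) (by omega)] at this
    omega
  refine ⟨?_, ?_⟩
  · intro i j hij
    unfold splitR
    dsimp only
    split_ifs with c1 c2 c3
    · omega
    · rw [h1 _ _ (by omega)]; omega
    · apply hd0; omega
    · apply h1; omega
  · intro k hk
    rw [Finset.sum_range_succ, Finset.sum_range_succ]
    have e1 : ∑ j ∈ Finset.range (m + 1), splitR m b r d (k, j) = ∑ j ∈ Finset.range (m + 1), r (k, j) := by
      apply Finset.sum_congr rfl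
      intro j hj
      rw [Finset.mem_range] at hj
      unfold splitR
      dsimp only
      rw [if_neg (by omega), if_neg (by omega)]
    rw [e1]
    have e3 : splitR m b r d (k, m + 1) = d k := by
      simp [splitR]
    rcases Nat.lt_or_ge m k with hk' | hk'
    · have : k = m + 1 := by omega
      subst this
      have e2 : ∑ i ∈ Finset.range (m + 1), splitR m b r d (i, m + 1) = ∑ i ∈ Finset.range (m + 1), d i := by
        apply Finset.sum_congr rfl
        intro j hj
        simp [splitR]
      have e4 : splitR m b r d (m + 1, m + 1 + 1) = b (m + 1) + ∑ i ∈ Finset.range (m + 1), d i := by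
        simp [splitR]
      have e5 : ∑ j ∈ Finset.range (m + 1), r (m + 1, j) = 0 := by
        apply Finset.sum_eq_zero
        intro j hj
        rw [Finset.mem_range] at hj
        apply h1; omega
      rw [e2, e3, e4, e5, hd0 _ (by omega)]
      ring
    · have e2 : ∑ i ∈ Finset.range k, splitR m b r d (i, k) = ∑ i ∈ Finset.range k, r (i, k) := by
        apply Finset.sum_congr rfl
        intro j hj
        unfold splitR
        dsimp only
        rw [if_neg (by omega), if_neg (by omega)]
      have e4 : splitR m b r d (k, m + 1 + 1) = r (k, m + 1) - d k := by
        unfold splitR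
        dsimp only
        rw [if_pos rfl, if_neg (by omega)]
      have := h2 k hk'
      rw [Finset.sum_range_succ] at this
      have := hd k
      rw [e2, e3, e4]
      omega

lemma split_merge (m : ℕ) (b : ℕ → ℕ) (r : ℕ × ℕ → ℕ) (h : IsFlow (m + 1) b r) :
    splitR m b (mergeR m r) (fun i => r (i, m + 1)) = r := by
  obtain ⟨h1, h2⟩ := h
  funext ⟨i, j⟩
  unfold splitR mergeR
  dsimp only
  by_cases c1 : j = m + 2
  · subst c1
    rw [if_pos rfl]
    by_cases c2 : i = m + 1
    · subst c2
      rw [if_pos rfl]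
      have := h2 (m + 1) le_rfl
      rw [Finset.sum_range_succ, Finset.sum_eq_zero] at this
      · rw [← this]; simp
      · intro j hj
        rw [Finset.mem_range] at hj
        apply h1; omega
    · rw [if_neg c2, if_pos rfl]
      split_ifs with c3
      · omega
      · rw [h1 i (m + 1) (by omega), h1 i (m + 2) (by omega)]
  · rw [if_neg c1]
    by_cases c2 : j = m + 1
    · subst c2; rw [if_pos rfl]
    · rw [if_neg c2, if_neg c2, if_neg c1]

lemma merge_split (m : ℕ) (b : ℕ → ℕ) (r : ℕ × ℕ → ℕ) (d : ℕ → ℕ) (h : IsFlow m b r)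
    (hd : ∀ i, d i ≤ r (i, m + 1)) : mergeR m (splitR m b r d) = r := by
  obtain ⟨h1, h2⟩ := h
  funext ⟨i, j⟩
  unfold splitR mergeR
  dsimp only
  have := hd i
  split_ifs <;> first | omega | (subst_vars; first | omega | rfl | (rw [h1]; omega))

lemma extD_le (m : ℕ) (r : ℕ × ℕ → ℕ) (p : ∀ i ∈ Finset.range (m + 1), ℕ)
    (hp : p ∈ (Finset.range (m + 1)).pi (fun i => Finset.range (r (i, m + 1) + 1))) (i : ℕ) :
    extD m p i ≤ r (i, m + 1) := by
  unfold extD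
  split_ifs with h
  · have := Finset.mem_pi.mp hp i h
    rw [Finset.mem_range] at this
    omega
  · omega

open Classical in
noncomputable def flows (b : ℕ → ℕ) : ℕ → Finset (ℕ × ℕ → ℕ)
  | 0 => {fun x => if x = (0, 1) then b 0 else 0}
  | m + 1 => ((flows b m).sigma
      (fun r => (Finset.range (m + 1)).pi (fun i => Finset.range (r (i, m + 1) + 1)))).image
      (fun x => splitR m b x.1 (extD m x.2))

lemma mem_flows (b : ℕ → ℕ) (m : ℕ) (r : ℕ × ℕ → ℕ) : r ∈ flows b m ↔ IsFlow m b r := by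
  induction m generalizing r with
  | zero =>
    simp only [flows, Finset.mem_singleton]
    constructor
    · rintro rfl
      refine ⟨?_, ?_⟩
      · intro i j hij
        dsimp only
        rw [if_neg]
        rintro ⟨⟩
        omega
      · intro k hk
        obtain rfl : k = 0 := by omega
        simp
    · rintro ⟨h1, h2⟩
      funext ⟨i, j⟩
      split_ifs with h
      · rw [h]
        have := h2 0 le_rfl
        simp only [Finset.sum_range_succ, Finset.sum_range_zero] at this
        rw [h1 0 0 (by omega)] at this
        omega
      · apply h1
        rintro ⟨h3, h4⟩
        apply h
        ext <;> simp <;> omega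
  | succ m ih =>
    simp only [flows, Finset.mem_image, Finset.mem_sigma]
    constructor
    · rintro ⟨⟨r', p⟩, ⟨h1, h2⟩, rfl⟩
      exact split_flow m b r' _ ((ih r').mp h1) (extD_le m r' p h2)
    · intro h
      refine ⟨⟨mergeR m r, fun i _ => r (i, m + 1)⟩, ⟨(ih _).mpr (merge_flow m b r h), ?_⟩, ?_⟩
      · rw [Finset.mem_pi]
        intro i hi
        rw [Finset.mem_range] at *
        have : mergeR m r (i, m + 1) = r (i, m + 1) + r (i, m + 2) := by
          unfold mergeR
          dsimp only
          rw [if_pos rfl, if_pos (by omega)]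
        simp only [this]
        omega
      · have e : extD m (fun i _ => r (i, m + 1)) = fun i => r (i, m + 1) := by
          funext i
          unfold extD
          split_ifs with hi
          · rfl
          · rw [Finset.mem_range] at hi
            rw [h.1]; omega
        dsimp only
        rw [e, split_merge m b r h]

lemma sum_flows_succ (b : ℕ → ℕ) (m : ℕ) (F : (ℕ × ℕ → ℕ) → RatFunc ℚ) :
    ∑ r ∈ flows b (m + 1), F r = ∑ r ∈ flows b m,
      ∑ p ∈ (Finset.range (m + 1)).pi (fun i => Finset.range (r (i, m + 1) + 1)),
        F (splitR m b r (extD m p)) := by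
  classical
  rw [flows, Finset.sum_image, Finset.sum_sigma]
  rintro ⟨r, p⟩ h ⟨r', p'⟩ h' e
  simp only [Finset.coe_sigma, Set.mem_sigma_iff, Finset.mem_coe] at h h'
  dsimp only at e
  have hr : r = r' := by
    rw [← merge_split m b r _ ((mem_flows b m r).mp h.1) (extD_le m r p h.2), e,
      merge_split m b r' _ ((mem_flows b m r').mp h'.1) (extD_le m r' p' h'.2)]
  subst hr
  have hp : p = p' := by
    funext i hi
    have := congrFun e (i, m + 1)
    simpa [splitR, extD, hi, Finset.mem_range.mp hi] using this
  rw [hp]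

lemma flow_total (b : ℕ → ℕ) (m : ℕ) (r : ℕ × ℕ → ℕ) (h : IsFlow m b r) :
    ∑ i ∈ Finset.range (m + 1), r (i, m + 1) = ∑ i ∈ Finset.range (m + 1), b i := by
  induction m generalizing r with
  | zero =>
    have := h.2 0 le_rfl
    have h0 := h.1 0 0 (by omega)
    simp only [Finset.sum_range_succ, Finset.sum_range_zero, h0] at this
    simp; omega
  | succ m ih =>
    have h3 := ih _ (merge_flow m b r h)
    have h2 := h.2 (m + 1) le_rfl
    rw [Finset.sum_range_succ, Finset.sum_eq_zero] at h2
    · have e : ∑ i ∈ Finset.range (m + 1), mergeR m r (i, m + 1)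
          = ∑ i ∈ Finset.range (m + 1), r (i, m + 1) + ∑ i ∈ Finset.range (m + 1), r (i, m + 2) := by
        rw [← Finset.sum_add_distrib]
        apply Finset.sum_congr rfl
        intro i hi
        rw [Finset.mem_range] at hi
        unfold mergeR
        dsimp only
        rw [if_pos rfl, if_pos (by omega)]
      rw [e] at h3
      rw [Finset.sum_range_succ, Finset.sum_range_succ _ (m + 1), ← h3]
      have : m + 1 + 1 = m + 2 := rfl
      rw [this] at *
      omega
    · intro j hj
      rw [Finset.mem_range] at hj
      apply h.1; omega

noncomputable def TT (m : ℕ) (h : ℕ → RatFunc ℚ) (b : ℕ → ℕ) : RatFunc ℚ :=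
  ∑ r ∈ flows b m, (∏ j ∈ Finset.range (m + 1), ∏ i ∈ Finset.range j, hh 1 (r (i, j))) *
    ∏ i ∈ Finset.range (m + 1), h (r (i, m + 1))

lemma TT_scale (m : ℕ) (h : ℕ → RatFunc ℚ) (b : ℕ → ℕ) (c : RatFunc ℚ) :
    TT m (fun k => h k * c ^ k) b = TT m h b * c ^ (∑ i ∈ Finset.range (m + 1), b i) := by
  unfold TT
  rw [Finset.sum_mul]
  apply Finset.sum_congr rfl
  intro r hr
  rw [Finset.prod_mul_distrib, Finset.prod_pow_eq_pow_sum,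
    flow_total b m r ((mem_flows b m r).mp hr)]
  ring

lemma sum_pi_conv (m : ℕ) (k : ℕ → ℕ) (u : RatFunc ℚ) (N : ℕ) :
    ∑ p ∈ (Finset.range (m + 1)).pi (fun i => Finset.range (k i + 1)),
      ((∏ i ∈ Finset.range (m + 1), hh 1 (extD m p i)) *
        (∏ i ∈ Finset.range (m + 1), hh N (k i - extD m p i)) *
        u ^ (∑ i ∈ Finset.range (m + 1), extD m p i)) =
    ∏ i ∈ Finset.range (m + 1), ∑ d ∈ Finset.range (k i + 1), (hh 1 d * u ^ d) * hh N (k i - d) := by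
  rw [Finset.prod_sum]
  apply Finset.sum_congr rfl
  intro p hp
  rw [← Finset.prod_pow_eq_pow_sum, ← Finset.prod_mul_distrib, ← Finset.prod_mul_distrib,
    ← Finset.prod_attach]
  apply Finset.prod_congr rfl
  rintro ⟨i, hi⟩ -
  have : extD m p i = p i hi := by simp only [extD, hi, dif_pos]
  dsimp only
  rw [this]
  ring

lemma TT_succ (m N : ℕ) (b : ℕ → ℕ) (hb : 0 < b (m + 1)) :
    TT (m + 1) (hh N) b = cA N * ((q ^ N) ^ b (m + 1) - (q⁻¹) ^ (∑ i ∈ Finset.range (m + 2), b i))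
      * TT m (hh (N + 1)) b := by
  have key : TT (m + 1) (hh N) b = cA N * ((q ^ N) ^ b (m + 1) * TT m (hh (N + 1)) b -
      (q⁻¹) ^ b (m + 1) * TT m (fun k => hh (N + 1) k * (q⁻¹) ^ k) b) := by
    conv_lhs => unfold TT
    rw [sum_flows_succ]
    unfold TT
    rw [Finset.mul_sum, Finset.mul_sum, ← Finset.sum_sub_distrib, Finset.mul_sum]
    apply Finset.sum_congr rfl
    intro r hr
    have c1 := sum_pi_conv m (fun i => r (i, m + 1)) (q ^ N) N
    have c2 := sum_pi_conv m (fun i => r (i, m + 1)) (q⁻¹) N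
    simp only [conv1] at c1
    simp only [conv2] at c2
    rw [← c1, ← c2]
    simp only [Finset.mul_sum]
    rw [← Finset.sum_sub_distrib, Finset.mul_sum]
    apply Finset.sum_congr rfl
    intro p hp
    set d := extD m p with hd
    rw [Finset.prod_range_succ _ (m + 1), Finset.prod_range_succ (fun i => hh N _) (m + 1)]
    have e1 : ∏ j ∈ Finset.range (m + 1), ∏ i ∈ Finset.range j, hh 1 (splitR m b r d (i, j)) =
        ∏ j ∈ Finset.range (m + 1), ∏ i ∈ Finset.range j, hh 1 (r (i, j)) := by
      apply Finset.prod_congr rfl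
      intro j hj
      rw [Finset.mem_range] at hj
      apply Finset.prod_congr rfl
      intro i hi
      unfold splitR
      dsimp only
      rw [if_neg (by omega), if_neg (by omega)]
    have e2 : ∏ i ∈ Finset.range (m + 1), hh 1 (splitR m b r d (i, m + 1)) =
        ∏ i ∈ Finset.range (m + 1), hh 1 (d i) := by
      apply Finset.prod_congr rfl
      intro i hi
      simp [splitR]
    have e3 : ∏ i ∈ Finset.range (m + 1), hh N (splitR m b r d (i, m + 1 + 1)) =
        ∏ i ∈ Finset.range (m + 1), hh N (r (i, m + 1) - d i) := by
      apply Finset.prod_congr rfl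
      intro i hi
      rw [Finset.mem_range] at hi
      unfold splitR
      dsimp only
      rw [if_pos rfl, if_neg (by omega)]
    have e4 : hh N (splitR m b r d (m + 1, m + 1 + 1)) =
        cA N * ((q ^ N) ^ b (m + 1) * (q ^ N) ^ (∑ i ∈ Finset.range (m + 1), d i)
          - (q⁻¹) ^ b (m + 1) * (q⁻¹) ^ (∑ i ∈ Finset.range (m + 1), d i)) := by
      have : splitR m b r d (m + 1, m + 1 + 1) = b (m + 1) + ∑ i ∈ Finset.range (m + 1), d i := by
        simp [splitR]
      rw [this, hh, if_neg (by omega), pow_add, pow_add]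
    rw [e1, e2, e3, e4]
    ring
  rw [key, TT_scale, Finset.sum_range_succ _ (m + 1), pow_add]
  ring

lemma TT_zero (N : ℕ) (b : ℕ → ℕ) (hb : b 0 = 0) : TT 0 (hh N) b = 1 := by
  simp [TT, flows, hb, hh]

lemma TT_formula (b : ℕ → ℕ) (hb : b 0 = 0) (m N : ℕ) (hpos : ∀ i, 1 ≤ i → i ≤ m → 0 < b i) :
    TT m (hh N) b = ∏ j ∈ Finset.range m, (cA (N + j) * ((q ^ (N + j)) ^ b (m - j)
      - (q⁻¹) ^ (∑ i ∈ Finset.range (m - j + 1), b i))) := by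
  induction m generalizing N with
  | zero => simp [TT_zero N b hb]
  | succ m ih =>
    rw [TT_succ m N b (hpos _ (by omega) le_rfl), ih (N + 1) (fun i h1 h2 => hpos i h1 (by omega)),
      Finset.prod_range_succ', mul_comm]
    congr 1
    apply Finset.prod_congr rfl
    intro j hj
    have e1 : N + 1 + j = N + (j + 1) := by ring
    have e2 : m + 1 - (j + 1) = m - j := by omega
    rw [e1, e2]

def aa (a : ℕ → ℤ) (k : ℕ) : ℤ := if k = 0 then 0 else a k

def bb (a : ℕ → ℤ) (k : ℕ) : ℕ := (aa a k - aa a (k - 1)).toNat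

lemma lam_apply (a : ℕ → ℤ) (m k : ℕ) :
    (∑ i ∈ Finset.Icc 1 m, a i • rootZ i (i + 1)) k =
      if k ≤ m then aa a k - aa a (k - 1) else if k = m + 1 then - aa a m else 0 := by
  rw [Finset.sum_apply]
  simp only [Pi.smul_apply, rootZ, smul_eq_mul, mul_sub, mul_ite, mul_one, mul_zero,
    Finset.sum_sub_distrib, Finset.sum_ite_eq, Finset.mem_Icc]
  cases k with
  | zero => simp [aa]
  | succ k =>
    simp only [add_left_inj, Finset.sum_ite_eq, Finset.mem_Icc, aa]
    split_ifs <;> first | omega | (exfalso; omega) | (subst_vars; simp)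

lemma root_sum_apply (m : ℕ) (r : ℕ × ℕ → ℕ) (h : ∀ p ∉ pairs (m + 1), r p = 0) (k : ℕ) :
    (∑ p ∈ pairs (m + 1), (r p : ℤ) • rootZ p.1 p.2) k =
      ∑ j ∈ Finset.range (m + 2), (r (k, j) : ℤ) - ∑ i ∈ Finset.range (m + 2), (r (i, k) : ℤ) := by
  have hz : ∀ i j, (m + 2 ≤ i ∨ m + 2 ≤ j) → r (i, j) = 0 := by
    intro i j hij
    apply h
    simp [pairs]
    omega
  have e : ∑ p ∈ pairs (m + 1), (r p : ℤ) • rootZ p.1 p.2 =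
      ∑ p ∈ Finset.range (m + 2) ×ˢ Finset.range (m + 2), (r p : ℤ) • rootZ p.1 p.2 := by
    apply Finset.sum_subset
    · rintro ⟨i, j⟩ hp
      simp [pairs] at hp ⊢
      omega
    · intro p _ hp
      simp [h p hp]
  rw [e, Finset.sum_apply]
  simp only [Pi.smul_apply, rootZ, smul_eq_mul, mul_sub, mul_ite, mul_one, mul_zero,
    Finset.sum_sub_distrib]
  congr 1
  · rw [Finset.sum_product_right]
    apply Finset.sum_congr rfl
    intro j hj
    simp only [Finset.sum_ite_eq]
    split_ifs with c
    · rfl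
    · rw [hz k j (by simp at c; omega)]; rfl
  · rw [Finset.sum_product]
    apply Finset.sum_congr rfl
    intro j hj
    simp only [Finset.sum_ite_eq]
    split_ifs with c
    · rfl
    · rw [hz j k (by simp at c; omega)]; rfl

lemma sum_range_in (m k : ℕ) (hk : k ≤ m + 1) (r : ℕ × ℕ → ℕ) (h : ∀ i j, ¬ i < j → r (i, j) = 0) :
    ∑ i ∈ Finset.range (m + 2), (r (i, k) : ℤ) = ((∑ i ∈ Finset.range k, r (i, k) : ℕ) : ℤ) := by
  push_cast
  symm
  apply Finset.sum_subset
  · intro i hi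
    simp at hi ⊢
    omega
  · intro i _ hi
    simp at hi
    rw [h i k (by omega)]; rfl

lemma aa_mono (a : ℕ → ℤ) (m : ℕ) (hpos : 0 < a 1)
    (hinc : ∀ i, 1 ≤ i → i + 1 ≤ m → a i < a (i + 1)) (k : ℕ) (h1 : 1 ≤ k) (h2 : k ≤ m) :
    aa a (k - 1) < aa a k := by
  obtain ⟨k, rfl⟩ : ∃ j, k = j + 1 := ⟨k - 1, by omega⟩
  rcases Nat.eq_zero_or_pos k with rfl | hk
  · simpa [aa] using hpos
  · have := hinc k hk h2
    simp only [aa, Nat.add_sub_cancel]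
    rw [if_neg (by omega), if_neg (by omega)]
    exact this

lemma bb_cast (a : ℕ → ℤ) (m : ℕ) (hpos : 0 < a 1)
    (hinc : ∀ i, 1 ≤ i → i + 1 ≤ m → a i < a (i + 1)) (k : ℕ) (h2 : k ≤ m) :
    (bb a k : ℤ) = aa a k - aa a (k - 1) := by
  unfold bb
  rcases Nat.eq_zero_or_pos k with rfl | hk
  · simp
  · have := aa_mono a m hpos hinc k hk h2
    omega

lemma bb_sum (a : ℕ → ℤ) (m : ℕ) (hpos : 0 < a 1)
    (hinc : ∀ i, 1 ≤ i → i + 1 ≤ m → a i < a (i + 1)) (k : ℕ) (h2 : k ≤ m) :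
    ((∑ i ∈ Finset.range (k + 1), bb a i : ℕ) : ℤ) = aa a k := by
  induction k with
  | zero => simp [bb, aa]
  | succ k ih =>
    rw [Finset.sum_range_succ, Nat.cast_add, ih (by omega), bb_cast a m hpos hinc _ h2]
    simp

lemma kostant_iff (a : ℕ → ℤ) (m : ℕ) (hpos : 0 < a 1)
    (hinc : ∀ i, 1 ≤ i → i + 1 ≤ m → a i < a (i + 1)) (r : ℕ × ℕ → ℕ) :
    IsKostant (m + 1) (∑ i ∈ Finset.Icc 1 m, a i • rootZ i (i + 1)) r ↔ IsFlow m (bb a) r := by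
  constructor
  · rintro ⟨h1, h2⟩
    have h3 : ∀ i j, ¬ (i < j ∧ j ≤ m + 1) → r (i, j) = 0 := by
      intro i j hij
      apply h1
      simp [pairs]
      omega
    refine ⟨h3, ?_⟩
    intro k hk
    have := congrFun h2 k
    rw [root_sum_apply m r h1, lam_apply, if_pos hk, ← bb_cast a m hpos hinc k hk,
      sum_range_in m k (by omega) r (fun i j h => h3 i j (by omega))] at this
    zify
    push_cast at this
    linarith
  · rintro h
    obtain ⟨h1, h2⟩ := id h
    have h0 : ∀ j, r (0, j) = 0 := by
      intro j
      have := h2 0 (by omega)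
      have hb : bb a 0 = 0 := by simp [bb]
      rw [hb, Finset.sum_range_zero, add_zero, Finset.sum_eq_zero_iff] at this
      rcases Nat.lt_or_ge j (m + 2) with hj | hj
      · exact this j (Finset.mem_range.mpr hj)
      · apply h1; omega
    have h3 : ∀ p ∉ pairs (m + 1), r p = 0 := by
      rintro ⟨i, j⟩ hp
      rcases Nat.eq_zero_or_pos i with rfl | hi
      · exact h0 j
      · apply h1
        intro hh
        apply hp
        simp [pairs]
        omega
    refine ⟨h3, ?_⟩
    funext k
    rw [root_sum_apply m r h3, lam_apply]
    split_ifs with c1 c2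
    · rw [sum_range_in m k (by omega) r (fun i j h => h1 i j (by omega)),
        ← bb_cast a m hpos hinc k c1, ← Nat.cast_sum, h2 k c1]
      push_cast
      ring
    · subst c2
      rw [sum_range_in m (m + 1) (by omega) r (fun i j h => h1 i j (by omega)),
        flow_total _ m r h, bb_sum a m hpos hinc m le_rfl, Finset.sum_eq_zero]
      · ring
      · intro j hj
        rw [Finset.mem_range] at hj
        rw [h1 _ _ (by omega)]; rfl
    · rw [Finset.sum_eq_zero, Finset.sum_eq_zero]
      · ring
      · intro j hj
        rw [h1 _ _ (by omega)]; rfl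
      · intro j hj
        rw [Finset.mem_range] at hj
        rw [h1 _ _ (by omega)]; rfl

lemma hh_zero (N : ℕ) : hh N 0 = 1 := by simp [hh]

lemma weight_eq (m : ℕ) (r : ℕ × ℕ → ℕ) (h : ∀ p ∉ pairs (m + 1), r p = 0) :
    ∏ p ∈ pairs (m + 1), wt (r p) =
      (∏ j ∈ Finset.range (m + 1), ∏ i ∈ Finset.range j, hh 1 (r (i, j))) *
        ∏ i ∈ Finset.range (m + 1), hh 1 (r (i, m + 1)) := by
  rw [← Finset.prod_range_succ (fun j => ∏ i ∈ Finset.range j, hh 1 (r (i, j)))]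
  simp only [wt_eq_hh]
  have e : ∏ p ∈ pairs (m + 1), hh 1 (r p) =
      ∏ p ∈ Finset.range (m + 2) ×ˢ Finset.range (m + 2), hh 1 (r p) := by
    apply Finset.prod_subset
    · rintro ⟨i, j⟩ hp
      simp [pairs] at hp ⊢
      omega
    · intro p _ hp
      rw [h p hp, hh_zero]
  rw [e, Finset.prod_product_right]
  apply Finset.prod_congr rfl
  intro j hj
  symm
  rw [Finset.mem_range] at hj
  apply Finset.prod_subset
  · intro i hi
    simp at hi ⊢
    omega
  · intro i _ hi
    rw [Finset.mem_range] at hi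
    rw [h, hh_zero]
    simp [pairs]
    omega

lemma S_eq_TT (a : ℕ → ℤ) (m : ℕ) (hpos : 0 < a 1)
    (hinc : ∀ i, 1 ≤ i → i + 1 ≤ m → a i < a (i + 1)) :
    S (m + 1) (∑ i ∈ Finset.Icc 1 m, a i • rootZ i (i + 1)) = TT m (hh 1) (bb a) := by
  unfold S TT
  have e : {r : ℕ × ℕ → ℕ | IsKostant (m + 1) (∑ i ∈ Finset.Icc 1 m, a i • rootZ i (i + 1)) r} =
      ↑(flows (bb a) m) := by
    ext r
    rw [Set.mem_ofPred_eq, Finset.mem_coe, mem_flows, kostant_iff a m hpos hinc]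
  rw [e, finsum_mem_coe_finset]
  apply Finset.sum_congr rfl
  intro r hr
  apply weight_eq
  exact ((kostant_iff a m hpos hinc r).mpr ((mem_flows _ _ _).mp hr)).1

lemma prod_cA (m : ℕ) : ∏ j ∈ Finset.range m, cA (1 + j) =
    (q - 1) ^ m * (q - 1) / (q ^ (m + 1) - 1) := by
  induction m with
  | zero =>
    have := q_sub_ne 1 (by norm_num)
    simp at this ⊢
    rw [div_self this]
  | succ m ih =>
    rw [Finset.prod_range_succ, ih, cA]
    have h1 := q_sub_ne (m + 1) (by omega)
    have h2 := q_sub_ne (m + 1 + 1) (by omega)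
    have e : 1 + m = m + 1 := by ring
    rw [e]
    field_simp
    ring

lemma term_eq (a : ℕ → ℤ) (m : ℕ) (hpos : 0 < a 1)
    (hinc : ∀ i, 1 ≤ i → i + 1 ≤ m → a i < a (i + 1)) (N k : ℕ) (h2 : k ≤ m) :
    (q ^ N) ^ bb a k - (q⁻¹) ^ (∑ i ∈ Finset.range (k + 1), bb a i) =
      q ^ (-(aa a k)) * (q ^ (((N : ℤ) + 1) * aa a k - N * aa a (k - 1)) - 1) := by
  have h1 := q_ne_zero'
  have e1 : (q ^ N) ^ bb a k = q ^ ((N : ℤ) * (aa a k - aa a (k - 1))) := by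
    rw [← bb_cast a m hpos hinc k h2, zpow_mul, zpow_natCast, zpow_natCast]
  have e2 : (q⁻¹) ^ (∑ i ∈ Finset.range (k + 1), bb a i) = q ^ (-(aa a k)) := by
    rw [← bb_sum a m hpos hinc k h2, zpow_neg, zpow_natCast, inv_pow]
  rw [e1, e2, mul_sub (q ^ _), ← zpow_add₀ h1, mul_one]
  congr 2
  ring

lemma zpow_sum' (a : ℕ → ℤ) (s : Finset ℕ) : q ^ (-(∑ i ∈ s, a i)) = ∏ i ∈ s, q ^ (-(a i)) := by
  induction s using Finset.induction_on with
  | empty => simp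
  | insert i s hi ih =>
    rw [Finset.sum_insert hi, Finset.prod_insert hi, neg_add, zpow_add₀ q_ne_zero', ih]

theorem trace_product_formula_increasing (n : ℕ) (hn : 2 ≤ n)
    (a : ℕ → ℤ)
    (hpos : 0 < a 1)
    (hinc : ∀ i, 1 ≤ i → i + 1 ≤ n - 1 → a i < a (i + 1)) :
    S n (∑ i ∈ Finset.Icc 1 (n - 1), a i • rootZ i (i + 1)) =
      q ^ (-(∑ i ∈ Finset.Icc 1 (n - 1), a i)) * (q - 1) ^ (2 * (n - 1)) *
        qint (q ^ (n : ℤ)) (a 1) *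
        ∏ j ∈ Finset.Icc 1 (n - 2), qint q (((j : ℤ) + 1) * a (n - j) - (j : ℤ) * a (n - j - 1)) := by
  obtain ⟨M, rfl⟩ : ∃ M, n = M + 1 + 1 := ⟨n - 2, by omega⟩
  have s1 : M + 1 + 1 - 1 = M + 1 := rfl
  have s2 : M + 1 + 1 - 2 = M := rfl
  rw [s1] at hinc
  rw [s1, s2, S_eq_TT a (M + 1) hpos hinc, TT_formula (bb a) (by simp [bb])]
  swap
  · intro i h1 h2
    have := aa_mono a (M + 1) hpos hinc i h1 h2
    unfold bb
    omega
  have hq1 : q - 1 ≠ 0 := by simpa using q_sub_ne 1 (by norm_num)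
  have hqn := q_sub_ne (M + 1 + 1) (by omega)
  rw [Finset.prod_mul_distrib, prod_cA]
  have e1 : ∀ j ∈ Finset.range (M + 1), ((q ^ (1 + j)) ^ bb a (M + 1 - j) -
      (q⁻¹) ^ (∑ i ∈ Finset.range (M + 1 - j + 1), bb a i)) =
      q ^ (-(a (M + 1 - j))) * (q ^ ((((1 + j : ℕ) : ℤ) + 1) * aa a (M + 1 - j)
        - ((1 + j : ℕ) : ℤ) * aa a (M + 1 - j - 1)) - 1) := by
    intro j hj
    rw [Finset.mem_range] at hj
    rw [term_eq a (M + 1) hpos hinc _ _ (by omega)]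
    congr 3
    simp only [aa]
    rw [if_neg (by omega)]
  rw [Finset.prod_congr rfl e1, Finset.prod_mul_distrib]
  have e2 : ∏ j ∈ Finset.range (M + 1), q ^ (-(a (M + 1 - j))) =
      q ^ (-(∑ i ∈ Finset.Icc 1 (M + 1), a i)) := by
    rw [zpow_sum', ← Finset.prod_range_reflect, Finset.range_eq_Ico]
    have : Finset.Icc 1 (M + 1) = Finset.Ico (0 + 1) (M + 1 + 1) := by
      ext; simp only [Finset.mem_Icc, Finset.mem_Ico]; omega
    rw [this, ← Finset.prod_Ico_add']
    apply Finset.prod_congr rfl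
    intro j hj
    rw [Finset.mem_Ico] at hj
    have : M + 1 - (M + 1 - 1 - j) = j + 1 := by omega
    rw [this]
  rw [e2, Finset.prod_range_succ]
  have e3 : q ^ ((((1 + M : ℕ) : ℤ) + 1) * aa a (M + 1 - M)
        - ((1 + M : ℕ) : ℤ) * aa a (M + 1 - M - 1)) - 1 =
      (q ^ (M + 1 + 1) - 1) * qint (q ^ ((M + 1 + 1 : ℕ) : ℤ)) (a 1) := by
    have : M + 1 - M = 1 := by omega
    rw [this]
    simp only [aa]
    unfold qint
    rw [zpow_natCast, mul_div_cancel₀ _ hqn]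
    rw [← zpow_natCast, ← zpow_mul]
    congr 2
    push_cast
    ring
  have e4 : ∏ j ∈ Finset.range M, (q ^ ((((1 + j : ℕ) : ℤ) + 1) * aa a (M + 1 - j)
        - ((1 + j : ℕ) : ℤ) * aa a (M + 1 - j - 1)) - 1) =
      (q - 1) ^ M * ∏ j ∈ Finset.Icc 1 M,
        qint q (((j : ℤ) + 1) * a (M + 1 + 1 - j) - (j : ℤ) * a (M + 1 + 1 - j - 1)) := by
    have : Finset.Icc 1 M = Finset.Ico (0 + 1) (M + 1) := by
      ext; simp only [Finset.mem_Icc, Finset.mem_Ico]; omega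
    rw [this, ← Finset.prod_Ico_add', ← Finset.range_eq_Ico]
    have hc : (q - 1) ^ M = ∏ j ∈ Finset.range M, (q - 1) := by simp
    rw [hc, ← Finset.prod_mul_distrib]
    apply Finset.prod_congr rfl
    intro j hj
    rw [Finset.mem_range] at hj
    unfold qint
    rw [mul_div_cancel₀ _ hq1]
    have t1 : M + 1 + 1 - (j + 1) = M + 1 - j := by omega
    rw [t1]
    simp only [aa]
    rw [if_neg (by omega), if_neg (by omega)]
    push_cast
    congr 2
    ring
  rw [e3, e4]
  field_simp
  ring
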